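/- arXiv:1912.07312 — 4 statements merged into one kernel-verified Lean document; each statement's English description precedes it below -/
import Mathlib

section
/- Let G = (V, E) be a finite directed acyclic graph, let s, t ∈ V, and let A = (V ∪ {x}, {a}, δ, {s}) be the DES constructed from G, s, t (transitions (p, a, r) for every edge (p, r) ∈ E, transitions (p, a, x) for every p ∈ V \ {t}, and self-loops (x, a, x) and (t, a, t)). If t is not reachable from s in G, then for every k ≥ |V|, δ({s}, a^k) = {x}. -/
/-! Common framework for discrete event systems (DES) modeled as NFAs. -/

/-- One step of the transition function extended to sets of states. -/
def dStep {Q E : Type*} (δ : Q → E → Set Q) (X : Set Q) (a : E) : Set Q :=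
  ⋃ q ∈ X, δ q a

/-- The transition function extended to sets of states and strings (lists of events). -/
def dRun {Q E : Type*} (δ : Q → E → Set Q) (X : Set Q) : List E → Set Q
  | [] => X
  | a :: w => dRun δ (dStep δ X a) w

/-- The natural projection erasing the unobservable events (those not in `obs`). -/
noncomputable def proj {E : Type*} (obs : Set E) : List E → List E
  | [] => []
  | a :: w => @ite _ (a ∈ obs) (Classical.propDecidable _)
      (a :: proj obs w) (proj obs w)

/-- `Rset δ obs X t` is the set `R(X, t)` of all states reachable from `X`
under some string whose projection is the observation `t`. -/
def Rset {Q E : Type*} (δ : Q → E → Set Q) (obs : Set E) (X : Set Q) (t : List E) : Set Q :=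
  {q | ∃ w : List E, proj obs w = t ∧ q ∈ dRun δ X w}

/-- `s : ℕ → E` is an infinite trajectory of the system, i.e. `s ∈ L^ω(G)`. -/
def IsTrajectory {Q E : Type*} (δ : Q → E → Set Q) (I : Set Q) (s : ℕ → E) : Prop :=
  ∃ r : ℕ → Q, r 0 ∈ I ∧ ∀ n, r (n + 1) ∈ δ (r n) (s n)

/-- The prefix of length `n` of an infinite trajectory. -/
def prefixOf {E : Type*} (s : ℕ → E) (n : ℕ) : List E := (List.range n).map s

/-- The segment of a trajectory between positions `m` and `m'`,
so that `prefixOf s m' = prefixOf s m ++ segmentOf s m m'` whenever `m ≤ m'`. -/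
def segmentOf {E : Type*} (s : ℕ → E) (m m' : ℕ) : List E :=
  (List.range (m' - m)).map fun i => s (m + i)

/-- Every state has at least one outgoing transition. -/
def DeadlockFree {Q E : Type*} (δ : Q → E → Set Q) : Prop :=
  ∀ q : Q, ∃ a : E, (δ q a).Nonempty

/-- No loop consists solely of unobservable events. -/
def NoUnobservableLoop {Q E : Type*} (δ : Q → E → Set Q) (obs : Set E) : Prop :=
  ∀ (q : Q) (w : List E), w ≠ [] → (∀ a ∈ w, a ∉ obs) → q ∉ dRun δ {q} w

/-- Strong detectability. -/
def StronglyDetectable {Q E : Type*} (δ : Q → E → Set Q) (obs : Set E) (I : Set Q) : Prop :=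
  ∃ n : ℕ, ∀ s : ℕ → E, IsTrajectory δ I s → ∀ m : ℕ,
    (proj obs (prefixOf s m)).length > n →
    (Rset δ obs I (proj obs (prefixOf s m))).ncard = 1

/-- Weak detectability. -/
def WeaklyDetectable {Q E : Type*} (δ : Q → E → Set Q) (obs : Set E) (I : Set Q) : Prop :=
  ∃ n : ℕ, ∃ s : ℕ → E, IsTrajectory δ I s ∧ ∀ m : ℕ,
    (proj obs (prefixOf s m)).length > n →
    (Rset δ obs I (proj obs (prefixOf s m))).ncard = 1

/-- Strong periodic detectability. -/
def StronglyPeriodicallyDetectable {Q E : Type*} (δ : Q → E → Set Q) (obs : Set E)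
    (I : Set Q) : Prop :=
  ∃ n : ℕ, ∀ s : ℕ → E, IsTrajectory δ I s → ∀ m : ℕ, ∃ m' : ℕ, m ≤ m' ∧
    (proj obs (segmentOf s m m')).length < n ∧
    (Rset δ obs I (proj obs (prefixOf s m'))).ncard = 1

/-- Weak periodic detectability. -/
def WeaklyPeriodicallyDetectable {Q E : Type*} (δ : Q → E → Set Q) (obs : Set E)
    (I : Set Q) : Prop :=
  ∃ n : ℕ, ∃ s : ℕ → E, IsTrajectory δ I s ∧ ∀ m : ℕ, ∃ m' : ℕ, m ≤ m' ∧
    (proj obs (segmentOf s m m')).length < n ∧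
    (Rset δ obs I (proj obs (prefixOf s m'))).ncard = 1

/-- Strong D-detectability with respect to a specification `T`. -/
def StronglyDDetectable {Q E : Type*} (δ : Q → E → Set Q) (obs : Set E) (I : Set Q)
    (T : Set (Q × Q)) : Prop :=
  ∃ n : ℕ, ∀ s : ℕ → E, IsTrajectory δ I s → ∀ m : ℕ,
    (proj obs (prefixOf s m)).length > n →
    (Rset δ obs I (proj obs (prefixOf s m)) ×ˢ Rset δ obs I (proj obs (prefixOf s m))) ∩ T = ∅

/-- Weak D-detectability with respect to a specification `T`. -/
def WeaklyDDetectable {Q E : Type*} (δ : Q → E → Set Q) (obs : Set E) (I : Set Q)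
    (T : Set (Q × Q)) : Prop :=
  ∃ n : ℕ, ∃ s : ℕ → E, IsTrajectory δ I s ∧ ∀ m : ℕ,
    (proj obs (prefixOf s m)).length > n →
    (Rset δ obs I (proj obs (prefixOf s m)) ×ˢ Rset δ obs I (proj obs (prefixOf s m))) ∩ T = ∅

/-- Strong periodic D-detectability with respect to a specification `T`. -/
def StronglyPeriodicallyDDetectable {Q E : Type*} (δ : Q → E → Set Q) (obs : Set E)
    (I : Set Q) (T : Set (Q × Q)) : Prop :=
  ∃ n : ℕ, ∀ s : ℕ → E, IsTrajectory δ I s → ∀ m : ℕ, ∃ m' : ℕ, m ≤ m' ∧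
    (proj obs (segmentOf s m m')).length < n ∧
    (Rset δ obs I (proj obs (prefixOf s m')) ×ˢ Rset δ obs I (proj obs (prefixOf s m'))) ∩ T = ∅

/-- Weak periodic D-detectability with respect to a specification `T`. -/
def WeaklyPeriodicallyDDetectable {Q E : Type*} (δ : Q → E → Set Q) (obs : Set E)
    (I : Set Q) (T : Set (Q × Q)) : Prop :=
  ∃ n : ℕ, ∃ s : ℕ → E, IsTrajectory δ I s ∧ ∀ m : ℕ, ∃ m' : ℕ, m ≤ m' ∧
    (proj obs (segmentOf s m m')).length < n ∧
    (Rset δ obs I (proj obs (prefixOf s m')) ×ˢ Rset δ obs I (proj obs (prefixOf s m'))) ∩ T = ∅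

/-- The transition function of the DES `A` constructed from a directed graph `Edge` on `V`
and a distinguished node `t : V`.  The state `none` plays the role of the new state `x`,
and `some v` represents the node `v ∈ V`.  There is a single (observable) event, modeled
by `Unit`.  Transitions: `(p, a, r)` for every edge `(p, r)`, `(p, a, x)` for every
`p ∈ V \\ {t}`, and the self-loops `(x, a, x)` and `(t, a, t)`. -/
def dagDelta {V : Type*} (Edge : V → V → Prop) (t : V) :
    Option V → Unit → Set (Option V)
  | none, _ => {none}
  | some p, _ =>
      {r : Option V | ∃ v : V, Edge p v ∧ r = some v} ∪
      @ite _ (p = t) (Classical.propDecidable _)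
        ({some t} : Set (Option V)) ({none} : Set (Option V))

theorem dagDelta_nonempty {V : Type*} (Edge : V → V → Prop) (t : V) (q : Option V) :
    (dagDelta Edge t q ()).Nonempty := by
  cases q with
  | none => exact ⟨none, rfl⟩
  | some p =>
    by_cases h : p = t
    · exact ⟨some t, Or.inr (by simp [h])⟩
    · exact ⟨none, Or.inr (by simp [h])⟩

theorem edge_of_some_mem_dagDelta {V : Type*} {Edge : V → V → Prop} {t p v : V} (hp : p ≠ t)
    (h : some v ∈ dagDelta Edge t (some p) ()) : Edge p v := by
  rcases h with ⟨w, hw, hvw⟩ | h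
  · rwa [Option.some.inj hvw]
  · simp [hp] at h

theorem ncard_reachable_lt_of_edge {V : Type*} [Finite V] {Edge : V → V → Prop}
    (hacyclic : ∀ v : V, ¬ Relation.TransGen Edge v v) {p v : V} (h : Edge p v) :
    {u | Relation.ReflTransGen Edge v u}.ncard < {u | Relation.ReflTransGen Edge p u}.ncard := by
  refine Set.ncard_lt_ncard ⟨fun u hu => Relation.ReflTransGen.head h hu, fun hsub => ?_⟩
  have hvp : Relation.ReflTransGen Edge v p := hsub Relation.ReflTransGen.refl
  exact hacyclic p (Relation.TransGen.head' h hvp)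

/-- A run of length `k` from states that cannot reach `t` and have at most `k` reachable
nodes ends exactly in the state `none`. -/
theorem dRun_dagDelta_eq_singleton_none {V : Type*} [Finite V] {Edge : V → V → Prop}
    (hacyclic : ∀ v : V, ¬ Relation.TransGen Edge v v) {t : V} (k : ℕ) (X : Set (Option V))
    (hne : X.Nonempty)
    (hX : ∀ v, some v ∈ X → ¬ Relation.ReflTransGen Edge v t ∧
      {u | Relation.ReflTransGen Edge v u}.ncard ≤ k) :
    dRun (dagDelta Edge t) X (List.replicate k ()) = {none} := by
  induction k generalizing X with
  | zero =>
    refine hne.subset_singleton_iff.mp fun q hq => ?_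
    cases q with
    | none => rfl
    | some v =>
      have hpos : 0 < {u | Relation.ReflTransGen Edge v u}.ncard :=
        (Set.ncard_pos).mpr ⟨v, Relation.ReflTransGen.refl⟩
      exact absurd (hX v hq).2 hpos.not_ge
  | succ k ih =>
    rw [List.replicate_succ, dRun]
    refine ih _ ?_ fun v hv => ?_
    · obtain ⟨q, hq⟩ := hne
      obtain ⟨r, hr⟩ := dagDelta_nonempty Edge t q
      exact ⟨r, Set.mem_biUnion hq hr⟩
    · obtain ⟨q, hq, hv⟩ := Set.mem_iUnion₂.mp hv
      cases q with
      | none => exact absurd hv (Option.some_ne_none v)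
      | some p =>
        obtain ⟨hpt, hcard⟩ := hX p hq
        have hne : p ≠ t := fun h => hpt (h ▸ Relation.ReflTransGen.refl)
        have hpv := edge_of_some_mem_dagDelta hne hv
        have hlt := ncard_reachable_lt_of_edge hacyclic hpv
        exact ⟨fun h => hpt (Relation.ReflTransGen.head hpv h), by omega⟩

/-- if `t` is not reachable from `s` in the finite DAG `(V, Edge)`, then in the
constructed DES `A`, for every `k ≥ |V|`, `δ({s}, a^k) = {x}`. -/
theorem statement5 {V : Type*} [Fintype V] (Edge : V → V → Prop)
    (hacyclic : ∀ v : V, ¬ Relation.TransGen Edge v v) (s t : V)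
    (hunreach : ¬ Relation.ReflTransGen Edge s t) :
    ∀ k : ℕ, Fintype.card V ≤ k →
      dRun (dagDelta Edge t) ({some s} : Set (Option V)) (List.replicate k ()) =
        ({none} : Set (Option V)) := by
  intro k hk
  refine dRun_dagDelta_eq_singleton_none hacyclic k _ (Set.singleton_nonempty _) fun v hv => ?_
  obtain rfl : v = s := Option.some.inj hv
  refine ⟨hunreach, le_trans ?_ hk⟩
  rw [← Nat.card_eq_fintype_card]
  exact Set.ncard_le_card _
end

section
/- Let A_1, …, A_n with A_i = (Q_i, {0,1}, δ_i, q_{0,i}, F_i) be total DFAs over the alphabet {0,1} with pairwise disjoint state sets, and let G be the DES over Σ' = {0, 1, a} constructed from A_1, …, A_n with new states q^-, q_1^+, …, q_n^+ and initial states I = {q^-, q_{0,1}, …, q_{0,n}} (G contains all states and transitions of every A_i; the transition (q, a, q^-) for every non-marked q ∈ Q_i \ F_i; the transition (q, a, q_i^+) for every marked q ∈ F_i; the self-loop (q^-, σ, q^-) for every σ ∈ Σ'; and the cycle transitions (q_i^+, σ, q_{i+1}^+) for 1 ≤ i < n and (q_n^+, σ, q_1^+) for every σ ∈ Σ'). Then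 for every string w ∈ {0,1}*, the set of states of G reachable from I under the string w·a equals {q^-} ∪ {q_i^+ : w ∈ L(A_i)}. -/
/-- The state set of the DES `G` built from `n` DFAs with pairwise disjoint state sets
`Qi i`: the states of the DFAs (as a disjoint union) together with the `n + 1` new states,
where `Sum.inr none` is the state `q^-` and `Sum.inr (some i)` is the state `q_{i+1}^+`
(so `Sum.inr (some 0)` is `q_1^+`). -/
abbrev GSt {n : ℕ} (Qi : Fin n → Type*) : Type _ := (Σ i : Fin n, Qi i) ⊕ Option (Fin n)

/-- The run of the `i`-th total DFA on an input word over `{0, 1}` (modeled as `Bool`). -/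
def dfaRun {n : ℕ} {Qi : Fin n → Type*} (δi : ∀ i, Qi i → Bool → Qi i) (i : Fin n)
    (q : Qi i) : List Bool → Qi i
  | [] => q
  | b :: w => dfaRun δi i (δi i q b) w

/-- The language of the `i`-th DFA (with initial state `q0 i` and marked states `F i`). -/
def dfaLang {n : ℕ} {Qi : Fin n → Type*} (δi : ∀ i, Qi i → Bool → Qi i)
    (q0 : ∀ i, Qi i) (F : ∀ i, Set (Qi i)) (i : Fin n) : Set (List Bool) :=
  {w : List Bool | dfaRun δi i (q0 i) w ∈ F i}

/-- The transition function of the DES `G` over `Σ' = {0, 1, a}` (modeled as `Option Bool`,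
where `some b` is the letter `b ∈ {0, 1}` and `none` is the new event `a`):
`G` contains all transitions of every DFA `A_i`; the transition `(q, a, q^-)` for every
non-marked state `q` of `A_i`; the transition `(q, a, q_i^+)` for every marked state `q` of
`A_i`; the self-loop `(q^-, σ, q^-)` for every `σ ∈ Σ'`; and the cycle transitions
`(q_i^+, σ, q_{i+1}^+)` for `1 ≤ i < n` and `(q_n^+, σ, q_1^+)` for every `σ ∈ Σ'`. -/
noncomputable def gDelta {n : ℕ} [NeZero n] {Qi : Fin n → Type*}
    (δi : ∀ i, Qi i → Bool → Qi i) (F : ∀ i, Set (Qi i)) :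
    GSt Qi → Option Bool → Set (GSt Qi)
  | Sum.inl ⟨i, q⟩, some b => {Sum.inl ⟨i, δi i q b⟩}
  | Sum.inl ⟨i, q⟩, none =>
      @ite _ (q ∈ F i) (Classical.propDecidable _)
        ({Sum.inr (some i)} : Set (GSt Qi)) ({Sum.inr none} : Set (GSt Qi))
  | Sum.inr none, _ => {Sum.inr none}
  | Sum.inr (some i), _ => {Sum.inr (some (i + 1))}

/-- The initial states `I = {q^-, q_{0,1}, …, q_{0,n}}` of the DES `G`. -/
def gInit {n : ℕ} {Qi : Fin n → Type*} (q0 : ∀ i, Qi i) : Set (GSt Qi) :=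
  {x : GSt Qi | x = Sum.inr none ∨ ∃ i : Fin n, x = Sum.inl ⟨i, q0 i⟩}

/-- A letter of `{0, 1}` moves the initial set of `G` to the one whose DFAs start at the
successors of their initial states. -/
theorem dStep_gInit_some {n : ℕ} [NeZero n] {Qi : Fin n → Type*}
    (δi : ∀ i, Qi i → Bool → Qi i) (q0 : ∀ i, Qi i) (F : ∀ i, Set (Qi i)) (b : Bool) :
    dStep (gDelta δi F) (gInit q0) (some b) = gInit fun i => δi i (q0 i) b := by
  ext x
  simp only [dStep, gInit, Set.mem_iUnion, Set.mem_ofPred_eq, exists_prop]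
  constructor
  · rintro ⟨q, rfl | ⟨i, rfl⟩, hx⟩
    · exact Or.inl hx
    · exact Or.inr ⟨i, hx⟩
  · rintro (rfl | ⟨i, rfl⟩)
    · exact ⟨Sum.inr none, Or.inl rfl, rfl⟩
    · exact ⟨Sum.inl ⟨i, q0 i⟩, Or.inr ⟨i, rfl⟩, rfl⟩

/-- The event `a` moves the initial set of `G` to `q^-` together with the states `q_i^+` of the
DFAs whose initial state is marked. -/
theorem dStep_gInit_none {n : ℕ} [NeZero n] {Qi : Fin n → Type*}
    (δi : ∀ i, Qi i → Bool → Qi i) (q0 : ∀ i, Qi i) (F : ∀ i, Set (Qi i)) :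
    dStep (gDelta δi F) (gInit q0) none =
      {x : GSt Qi | x = Sum.inr none ∨ ∃ i : Fin n, q0 i ∈ F i ∧ x = Sum.inr (some i)} := by
  ext x
  simp only [dStep, gInit, Set.mem_iUnion, Set.mem_ofPred_eq, exists_prop]
  constructor
  · rintro ⟨q, rfl | ⟨i, rfl⟩, hx⟩
    · exact Or.inl hx
    · by_cases h : q0 i ∈ F i
      · simp only [gDelta, if_pos h, Set.mem_singleton_iff] at hx
        exact Or.inr ⟨i, h, hx⟩
      · simp only [gDelta, if_neg h, Set.mem_singleton_iff] at hx
        exact Or.inl hx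
  · rintro (rfl | ⟨i, h, rfl⟩)
    · exact ⟨Sum.inr none, Or.inl rfl, rfl⟩
    · refine ⟨Sum.inl ⟨i, q0 i⟩, Or.inr ⟨i, rfl⟩, ?_⟩
      simp only [gDelta, if_pos h, Set.mem_singleton_iff]

/-- in the DES `G` constructed from the total DFAs `A_1, …, A_n`, for every
word `w ∈ {0,1}*`, the set of states reachable from `I` under the string `w · a` equals
`{q^-} ∪ {q_i^+ : w ∈ L(A_i)}`. -/
theorem statement9 {n : ℕ} [NeZero n] {Qi : Fin n → Type*} [∀ i, Fintype (Qi i)]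
    (δi : ∀ i, Qi i → Bool → Qi i) (q0 : ∀ i, Qi i) (F : ∀ i, Set (Qi i)) :
    ∀ w : List Bool,
      dRun (gDelta δi F) (gInit q0) (w.map some ++ [none]) =
        {x : GSt Qi | x = Sum.inr none ∨
          ∃ i : Fin n, w ∈ dfaLang δi q0 F i ∧ x = Sum.inr (some i)} := by
  intro w
  induction w generalizing q0 with
  | nil => exact dStep_gInit_none δi q0 F
  | cons b w ih =>
    simp only [List.map_cons, List.cons_append, dRun, dStep_gInit_some, ih]
    rfl
end

section
/- Let G = (Q, Σ, δ, I) be a DES with a single observable event, i.e., Σ_o = {a}, and let T_spec ⊆ Q × Q be a specification. Then G is weakly D-detectable with respect to T_spec if and only if G is strongly D-detectable with respect to T_spec. -/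
theorem length_proj_append {E : Type*} (obs : Set E) (u v : List E) :
    (proj obs (u ++ v)).length = (proj obs u).length + (proj obs v).length := by
  induction u with
  | nil => simp [proj]
  | cons b u ih =>
    by_cases h : b ∈ obs
    · simp [proj, h, ih]; omega
    · simp [proj, h, ih]

theorem proj_singleton_eq_replicate {E : Type*} (a : E) (w : List E) :
    proj {a} w = List.replicate (proj {a} w).length a := by
  induction w with
  | nil => simp [proj]
  | cons b w ih =>
    by_cases h : b = a
    · subst h
      simpa [proj, List.replicate_succ] using ih
    · simpa [proj, h] using ih

theorem length_proj_prefixOf_succ {E : Type*} (obs : Set E) (s : ℕ → E) (m : ℕ) :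
    (proj obs (prefixOf s (m + 1))).length =
      (proj obs (prefixOf s m)).length + (proj obs [s m]).length := by
  simp [prefixOf, List.range_succ, length_proj_append]

theorem mem_dRun_segmentOf {Q E : Type*} {δ : Q → E → Set Q} {s : ℕ → E} {r : ℕ → Q}
    (hr : ∀ n, r (n + 1) ∈ δ (r n) (s n)) (d m : ℕ) (X : Set Q) (hX : r m ∈ X) :
    r (m + d) ∈ dRun δ X (segmentOf s m (m + d)) := by
  induction d generalizing m X with
  | zero => simpa [segmentOf, dRun] using hX
  | succ d ih =>
    have hstep : r (m + 1) ∈ dStep δ X (s m) := by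
      simp only [dStep, Set.mem_iUnion]
      exact ⟨r m, hX, hr m⟩
    have hseg : segmentOf s m (m + (d + 1)) = s m :: segmentOf s (m + 1) (m + 1 + d) := by
      rw [segmentOf, segmentOf, Nat.add_sub_cancel_left, Nat.add_sub_cancel_left]
      simp [List.range_succ_eq_map, Function.comp_def, Nat.add_assoc, Nat.add_comm 1]
    rw [hseg, show m + (d + 1) = m + 1 + d by omega]
    exact ih (m + 1) _ hstep

/-- Observable events occur infinitely often along every trajectory. -/
theorem NoUnobservableLoop.exists_observable_ge {Q E : Type*} [Finite Q] {δ : Q → E → Set Q}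
    {obs : Set E} (hnl : NoUnobservableLoop δ obs) {s : ℕ → E} {r : ℕ → Q}
    (hr : ∀ n, r (n + 1) ∈ δ (r n) (s n)) (m : ℕ) : ∃ m' ≥ m, s m' ∈ obs := by
  by_contra! h
  obtain ⟨i, j, hij, heq⟩ := Finite.exists_ne_map_eq_of_infinite fun i => r (m + i)
  wlog hlt : i < j generalizing i j
  · exact this j i hij.symm heq.symm (by omega)
  have hmem := mem_dRun_segmentOf hr (j - i) (m + i) {r (m + i)} rfl
  rw [show m + i + (j - i) = m + j by omega, ← heq] at hmem
  refine hnl _ _ ?_ ?_ hmem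
  · intro hnil
    have hlen := congrArg List.length hnil
    simp [segmentOf] at hlen
    omega
  · intro b hb
    obtain ⟨k, -, rfl⟩ := List.mem_map.1 hb
    exact h _ (by omega)

/-- Every observation length is attained along every trajectory. -/
theorem NoUnobservableLoop.exists_length_proj_eq {Q E : Type*} [Finite Q] {δ : Q → E → Set Q}
    {obs : Set E} (hnl : NoUnobservableLoop δ obs) {s : ℕ → E} {r : ℕ → Q}
    (hr : ∀ n, r (n + 1) ∈ δ (r n) (s n)) (k : ℕ) :
    ∃ m, (proj obs (prefixOf s m)).length = k := by
  induction k with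
  | zero => exact ⟨0, by simp [prefixOf, proj]⟩
  | succ k ih =>
    obtain ⟨m, hm⟩ := ih
    obtain ⟨m', hle, hobs⟩ := hnl.exists_observable_ge hr m
    obtain ⟨d, rfl⟩ := Nat.exists_eq_add_of_le hle
    induction d generalizing m with
    | zero => exact ⟨m + 1, by simp_all [length_proj_prefixOf_succ, proj]⟩
    | succ d ihd =>
      by_cases h : s m ∈ obs
      · exact ⟨m + 1, by simp [length_proj_prefixOf_succ, proj, h, hm]⟩
      · refine ihd (m + 1) ?_ (by omega) ?_
        · simp [length_proj_prefixOf_succ, proj, h, hm]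
        · rwa [show m + 1 + d = m + (d + 1) by omega]

theorem DeadlockFree.exists_isTrajectory {Q E : Type*} {δ : Q → E → Set Q} {I : Set Q}
    (hdf : DeadlockFree δ) (hI : I.Nonempty) : ∃ s : ℕ → E, IsTrajectory δ I s := by
  choose e f hf using hdf
  obtain ⟨q, hq⟩ := hI
  exact ⟨fun n => e (f^[n] q), fun n => f^[n] q, hq, fun n => by
    simpa only [Function.iterate_succ_apply'] using hf (f^[n] q)⟩

/-- for a DES `G = (Q, Σ, δ, I)` with a single observable event `Σ_o = {a}`
and a specification `T_spec ⊆ Q × Q`, `G` is weakly D-detectable w.r.t. `T_spec` if and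
only if `G` is strongly D-detectable w.r.t. `T_spec`. -/
theorem statement12 {Q E : Type*} [Fintype Q] [Fintype E]
    (δ : Q → E → Set Q) (a : E) (I : Set Q) (Tspec : Set (Q × Q))
    (hI : I.Nonempty) (hdf : DeadlockFree δ) (hnl : NoUnobservableLoop δ ({a} : Set E)) :
    WeaklyDDetectable δ ({a} : Set E) I Tspec ↔
      StronglyDDetectable δ ({a} : Set E) I Tspec := by
  constructor
  · rintro ⟨n, s, ⟨r, -, hr⟩, hs⟩
    refine ⟨n, fun s' _ m' hm' => ?_⟩
    obtain ⟨m, hm⟩ := hnl.exists_length_proj_eq hr (proj {a} (prefixOf s' m')).length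
    have heq : proj {a} (prefixOf s' m') = proj {a} (prefixOf s m) := by
      rw [proj_singleton_eq_replicate, ← hm, ← proj_singleton_eq_replicate]
    rw [heq] at hm' ⊢
    exact hs m hm'
  · rintro ⟨n, hn⟩
    obtain ⟨s, hs⟩ := hdf.exists_isTrajectory hI
    exact ⟨n, s, hs, hn s hs⟩
end

section
/- Let A = (Q, Σ, δ, I) be an rpoNFA, i.e., its reachability relation (p ≤ q iff there exists w ∈ Σ* with q ∈ δ(p, w)) is a partial order and for every q ∈ Q and a ∈ Σ, q ∈ δ(q, a) implies δ(q, a) = {q}. If X ⊆ Q is nonempty, w ∈ Σ* is a nonempty string, and δ(X, w) = X, then for every state p ∈ X and every event c occurring in w, δ(p, c) = {p}; in particular, δ(p, w) = {p} for every p ∈ X. -/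
theorem dStep_singleton {Q E : Type*} (δ : Q → E → Set Q) (p : Q) (a : E) :
    dStep δ {p} a = δ p a := by
  simp [dStep]

theorem dRun_append {Q E : Type*} (δ : Q → E → Set Q) (X : Set Q) (u v : List E) :
    dRun δ X (u ++ v) = dRun δ (dRun δ X u) v := by
  induction u generalizing X with
  | nil => rfl
  | cons a u ih => exact ih _

theorem mem_dRun_iff_exists {Q E : Type*} {δ : Q → E → Set Q} {X : Set Q} {w : List E} {q : Q} :
    q ∈ dRun δ X w ↔ ∃ p ∈ X, q ∈ dRun δ {p} w := by
  induction w generalizing X with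
  | nil => simp [dRun]
  | cons a w ih =>
    simp only [dRun, dStep_singleton]
    rw [ih]
    constructor
    · rintro ⟨r, hr, hq⟩
      obtain ⟨p, hp, hpr⟩ := Set.mem_iUnion₂.mp hr
      exact ⟨p, hp, ih.mpr ⟨r, hpr, hq⟩⟩
    · rintro ⟨p, hp, hq⟩
      obtain ⟨r, hr, hq⟩ := ih.mp hq
      exact ⟨r, Set.mem_iUnion₂.mpr ⟨p, hp, hr⟩, hq⟩

theorem mem_dRun_trans {Q E : Type*} {δ : Q → E → Set Q} {p q r : Q} {u v : List E}
    (hpq : q ∈ dRun δ {p} u) (hqr : r ∈ dRun δ {q} v) : r ∈ dRun δ {p} (u ++ v) := by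
  rw [dRun_append]
  exact mem_dRun_iff_exists.mpr ⟨q, hpq, hqr⟩

theorem dRun_singleton_eq_of_forall {Q E : Type*} {δ : Q → E → Set Q} {p : Q} {w : List E}
    (h : ∀ c ∈ w, δ p c = {p}) : dRun δ {p} w = {p} := by
  induction w with
  | nil => rfl
  | cons a w ih =>
    rw [dRun, dStep_singleton, h a (by simp)]
    exact ih fun c hc => h c (by simp [hc])

/-- In a partially ordered, self-loop deterministic automaton, every event of a string leading
from a state back to itself is a self-loop at that state. -/
theorem eq_singleton_of_mem_dRun_self {Q E : Type*} {δ : Q → E → Set Q}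
    (hanti : ∀ p q : Q, (∃ w : List E, q ∈ dRun δ ({p} : Set Q) w) →
      (∃ w : List E, p ∈ dRun δ ({q} : Set Q) w) → p = q)
    (hsl : ∀ (q : Q) (a : E), q ∈ δ q a → δ q a = ({q} : Set Q))
    {p : Q} {w : List E} (h : p ∈ dRun δ {p} w) : ∀ c ∈ w, δ p c = {p} := by
  induction w with
  | nil => simp
  | cons a w ih =>
    rw [dRun, dStep_singleton] at h
    obtain ⟨r, hr, hw⟩ := mem_dRun_iff_exists.mp h
    obtain rfl : p = r := hanti p r ⟨[a], by simpa [dRun, dStep_singleton] using hr⟩ ⟨w, hw⟩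
    intro c hc
    rcases List.mem_cons.mp hc with rfl | hc
    · exact hsl p c hr
    · exact ih hw c hc

/-- let `A = (Q, Σ, δ, I)` be an rpoNFA (its reachability relation is a
partial order — antisymmetry is the nontrivial requirement — and `q ∈ δ(q, a)` implies
`δ(q, a) = {q}`).  If `X ⊆ Q` is nonempty, `w` is a nonempty string, and `δ(X, w) = X`,
then `δ(p, c) = {p}` for every `p ∈ X` and every event `c` occurring in `w`; in
particular `δ(p, w) = {p}` for every `p ∈ X`. -/
theorem statement17 {Q E : Type*} [Fintype Q] (δ : Q → E → Set Q) (I : Set Q)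
    (hanti : ∀ p q : Q, (∃ w : List E, q ∈ dRun δ ({p} : Set Q) w) →
      (∃ w : List E, p ∈ dRun δ ({q} : Set Q) w) → p = q)
    (hsl : ∀ (q : Q) (a : E), q ∈ δ q a → δ q a = ({q} : Set Q))
    (X : Set Q) (hX : X.Nonempty) (w : List E) (hw : w ≠ [])
    (hfix : dRun δ X w = X) :
    (∀ p ∈ X, ∀ c ∈ w, δ p c = ({p} : Set Q)) ∧
    (∀ p ∈ X, dRun δ ({p} : Set Q) w = ({p} : Set Q)) := by
  let r : Q → Q → Prop := fun p q => (∃ u : List E, q ∈ dRun δ {p} u) ∧ p ≠ q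
  have : Std.Irrefl r := ⟨fun _ h => h.2 rfl⟩
  have : IsTrans Q r := by
    refine ⟨?_⟩
    rintro p q s ⟨⟨u, hu⟩, hpq⟩ ⟨⟨v, hv⟩, -⟩
    refine ⟨⟨u ++ v, mem_dRun_trans hu hv⟩, ?_⟩
    rintro rfl
    exact hpq (hanti p q ⟨u, hu⟩ ⟨v, hv⟩)
  have hwf : WellFounded r := Finite.wellFounded_of_trans_of_irrefl r
  have key : ∀ p ∈ X, ∀ c ∈ w, δ p c = ({p} : Set Q) := by
    intro p
    induction p using hwf.induction with
    | _ p ih =>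
      intro hp
      obtain ⟨q, hq, hqp⟩ := mem_dRun_iff_exists.mp (hfix.symm ▸ hp : p ∈ dRun δ X w)
      obtain rfl : p = q := by
        by_contra hne
        rw [dRun_singleton_eq_of_forall (ih q ⟨⟨w, hqp⟩, Ne.symm hne⟩ hq)] at hqp
        exact hne hqp
      exact eq_singleton_of_mem_dRun_self hanti hsl hqp
  exact ⟨key, fun p hp => dRun_singleton_eq_of_forall (key p hp)⟩
end
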